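/- For every integer k ≥ 1, if G is an acyclic digraph with |V(G)| ≥ 2 and with exactly one source, then G has a k-kernel K with k·(|K| − 1) ≤ |V(G)| − 2 (equivalently |K| ≤ 1 + (|V(G)|−2)/k). -/

import Mathlib

/-- There is a directed path (walk) of length at most `k` from `x` to `y`
in the digraph with adjacency relation `E`. -/
def ReachesIn {V : Type*} (E : V → V → Prop) : ℕ → V → V → Prop
  | 0, x, y => x = y
  | k + 1, x, y => x = y ∨ ∃ z, E x z ∧ ReachesIn E k z y

/-- `X` k-covers `Y`: every vertex of `Y` is joined from some vertex of `X`
by a directed path of length at most `k`. -/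
def KCovers {V : Type*} (E : V → V → Prop) (k : ℕ) (X Y : Set V) : Prop :=
  ∀ y ∈ Y, ∃ x ∈ X, ReachesIn E k x y

/-- `X` is a stable set: no edge has both ends in `X`. -/
def StableSet {V : Type*} (E : V → V → Prop) (X : Set V) : Prop :=
  ∀ x ∈ X, ∀ y ∈ X, ¬ E x y

/-- A `k`-kernel: a stable set that k-covers the whole vertex set. -/
def IsKernel {V : Type*} (E : V → V → Prop) (k : ℕ) (X : Set V) : Prop :=
  StableSet E X ∧ KCovers E k X Set.univ

/-- A source: a vertex of in-degree zero. -/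
def IsSource {V : Type*} (E : V → V → Prop) (v : V) : Prop := ∀ u, ¬ E u v

/-- An oriented graph: no loops and no directed cycles of length two. -/
def Oriented {V : Type*} (E : V → V → Prop) : Prop :=
  (∀ v, ¬ E v v) ∧ ∀ u v, E u v → ¬ E v u

/-- The induced subdigraph on a set `S` of vertices. -/
def Induce {V : Type*} (E : V → V → Prop) (S : Set V) : V → V → Prop :=
  fun a b => a ∈ S ∧ b ∈ S ∧ E a b

/-- `E` induces a tournament on `T`: any two distinct vertices of `T` are
joined by exactly one directed edge. -/
def IsTournamentOn {V : Type*} (E : V → V → Prop) (T : Set V) : Prop :=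
  ∀ u ∈ T, ∀ v ∈ T, u ≠ v → (E u v ∨ E v u) ∧ ¬ (E u v ∧ E v u)

/-- The relation `E` is acyclic: there is no directed cycle. -/
def AcyclicRel {V : Type*} (E : V → V → Prop) : Prop :=
  ∀ x y, E x y → ¬ Relation.ReflTransGen E y x

/-- A split of an oriented graph: a partition `(S,T)` of the vertex set
where `S` is stable and `T` induces a tournament. -/
def IsSplit {V : Type*} (E : V → V → Prop) (S T : Set V) : Prop :=
  S ∪ T = Set.univ ∧ Disjoint S T ∧ StableSet E S ∧ IsTournamentOn E T

/-- A break of an oriented graph: a partition `(S,T)` of the vertex set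
where `S` induces an acyclic digraph and `T` induces a tournament. -/
def IsBreak {V : Type*} (E : V → V → Prop) (S T : Set V) : Prop :=
  S ∪ T = Set.univ ∧ Disjoint S T ∧ AcyclicRel (Induce E S) ∧ IsTournamentOn E T

/-- `N⁺_G[X]`: the set of vertices that belong to `X` or have an in-neighbour in `X`. -/
def ClosedOut {V : Type*} (E : V → V → Prop) (X : Set V) : Set V :=
  {v | v ∈ X ∨ ∃ x ∈ X, E x v}

theorem ReachesIn.snoc {V : Type*} {E : V → V → Prop} {n : ℕ} {x y z : V}
    (h : ReachesIn E n x y) (hyz : E y z) : ReachesIn E (n + 1) x z := by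
  induction n generalizing x with
  | zero => exact Or.inr ⟨z, (show x = y from h) ▸ hyz, rfl⟩
  | succ n ih =>
    rcases h with rfl | ⟨w, hxw, hw⟩
    · exact Or.inr ⟨z, hyz, Or.inl rfl⟩
    · exact Or.inr ⟨w, hxw, ih hw⟩

theorem ReachesIn.mono {V : Type*} {E : V → V → Prop} {m n : ℕ} {x y : V}
    (h : ReachesIn E m x y) (hmn : m ≤ n) : ReachesIn E n x y := by
  induction n generalizing x m with
  | zero =>
    obtain rfl : m = 0 := by omega
    exact h
  | succ n ih =>
    cases m with
    | zero => exact Or.inl h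
    | succ m =>
      rcases h with h | ⟨w, hxw, hw⟩
      · exact Or.inl h
      · exact Or.inr ⟨w, hxw, ih hw (by omega)⟩

theorem AcyclicRel.wellFounded {V : Type*} [Finite V] {E : V → V → Prop}
    (hac : AcyclicRel E) : WellFounded E := by
  have : Std.Irrefl (Relation.TransGen E) := ⟨fun v h => by
    obtain ⟨w, hvw, hwv⟩ := Relation.TransGen.head'_iff.1 h
    exact hac v w hvw hwv⟩
  exact Subrelation.wf (r := Relation.TransGen E) Relation.TransGen.single
    (Finite.wellFounded_of_trans_of_irrefl _)

/-- Replacing a largest entry by zero, unless all entries are at most one, restores the bound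
on the number of large entries that is lost when all entries grow by one. -/
theorem exists_relabel {k : ℕ} (hk : 1 ≤ k) (m : Fin k → ℕ) :
    ∃ f : Fin k → ℕ, (∀ i, f i = m i ∨ f i = 0 ∧ 2 ≤ m i) ∧
      ((∀ i, 1 ≤ m i) → ∀ i j, f i = 0 → f j = 0 → i = j) ∧
      ((∀ t, (Finset.univ.filter fun i => t + 1 ≤ m i).card ≤ k + 1 - t) →
        ∀ t, (Finset.univ.filter fun i => t ≤ f i).card ≤ k + 1 - t) := by
  classical
  have : Nonempty (Fin k) := ⟨⟨0, hk⟩⟩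
  obtain ⟨i₀, hi₀⟩ := Finite.exists_max m
  have htriv (p : Fin k → Prop) [DecidablePred p] : (Finset.univ.filter p).card ≤ k :=
    (Finset.card_le_univ _).trans_eq (Fintype.card_fin k)
  by_cases h : m i₀ ≤ 1
  · refine ⟨m, fun i => Or.inl rfl, fun hm i j hi => by have := hm i; omega, fun _ t => ?_⟩
    by_cases ht : t ≤ 1
    · exact (htriv _).trans (by omega)
    · rw [Finset.filter_false_of_mem fun i _ => by have := hi₀ i; omega]
      simp
  · refine ⟨Function.update m i₀ 0, fun i => ?_, fun hm i j hi hj => ?_, fun hm t => ?_⟩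
    · by_cases hi : i = i₀
      · subst hi; right; simp; omega
      · left; simp [hi]
    · have key : ∀ i, Function.update m i₀ 0 i = 0 → i = i₀ := fun i hi => by
        by_contra hne
        rw [Function.update_of_ne hne] at hi
        have := hm i
        omega
      rw [key i hi, key j hj]
    · cases t with
      | zero => exact (htriv _).trans (by omega)
      | succ t =>
        by_cases ht : t + 1 ≤ m i₀
        · have hsub : (Finset.univ.filter fun i => t + 1 ≤ Function.update m i₀ 0 i) ⊆
              (Finset.univ.filter fun i => t + 1 ≤ m i).erase i₀ := fun i hi => by
            have hi := (Finset.mem_filter.1 hi).2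
            have hne : i ≠ i₀ := by rintro rfl; simp at hi
            rw [Function.update_of_ne hne] at hi
            exact Finset.mem_erase.2 ⟨hne, Finset.mem_filter.2 ⟨Finset.mem_univ _, hi⟩⟩
          have h1 := Finset.card_le_card hsub
          have hmem : i₀ ∈ Finset.univ.filter fun i => t + 1 ≤ m i :=
            Finset.mem_filter.2 ⟨Finset.mem_univ _, ht⟩
          rw [Finset.card_erase_of_mem hmem] at h1
          have := hm t
          omega
        · rw [Finset.filter_false_of_mem fun i _ => ?_]
          · simp
          · by_cases hi : i = i₀
            · subst hi; simp
            · rw [Function.update_of_ne hi]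
              have := hi₀ i
              omega

/-- Along a well-founded relation one can solve the recursion expressing the value at a non-source
in terms of the coordinatewise minimum of the values at its in-neighbours. -/
theorem exists_recursive_labelling {V ι : Type*} {E : V → V → Prop} (hwf : WellFounded E)
    (R : (ι → ℕ) → ι → ℕ) :
    ∃ d : V → ι → ℕ, (∀ v, IsSource E v → d v = 0) ∧
      ∀ v, ¬ IsSource E v → d v = R fun i => 1 + ⨅ u : {u // E u v}, d u i := by
  classical
  let F : ∀ v, (∀ u, E u v → ι → ℕ) → ι → ℕ := fun v rec =>
    if IsSource E v then 0 else R fun i => 1 + ⨅ u : {u // E u v}, rec u u.2 i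
  refine ⟨hwf.fix F, fun v hv => ?_, fun v hv => ?_⟩
  · rw [hwf.fix_eq]; simp [F, hv]
  · rw [hwf.fix_eq]; simp [F, hv]

/-- In an acyclic digraph with a unique source `r` there are `k` distance labellings whose zero
sets are stable, `k`-cover the graph, pairwise meet only in `r`, and all avoid some vertex. -/
theorem exists_kernel_family {V : Type*} [Finite V] [Nontrivial V] {E : V → V → Prop} {k : ℕ}
    (hk : 1 ≤ k) (hac : AcyclicRel E) {r : V} (hr : IsSource E r)
    (hr' : ∀ v, IsSource E v → v = r) :
    ∃ d : V → Fin k → ℕ, (∀ i, IsKernel E k {v | d v i = 0}) ∧ d r = 0 ∧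
      (∀ v ≠ r, ∀ i j, d v i = 0 → d v j = 0 → i = j) ∧ ∃ a ≠ r, ∀ i, d a i ≠ 0 := by
  have hwf := hac.wellFounded
  choose R hR hinj hcard using exists_relabel hk
  obtain ⟨d, hd0, hd⟩ := exists_recursive_labelling hwf R
  set m : V → Fin k → ℕ := fun v i => 1 + ⨅ u : {u // E u v}, d u i with hm
  replace hd : ∀ v, ¬ IsSource E v → d v = R (m v) := hd
  have hm_le {u v : V} (huv : E u v) (i : Fin k) : m v i ≤ 1 + d u i :=
    Nat.add_le_add_left (ciInf_le (OrderBot.bddBelow _) (⟨u, huv⟩ : {u // E u v})) 1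
  have hm_eq {v : V} (hv : ¬ IsSource E v) (i : Fin k) : ∃ u, E u v ∧ m v i = 1 + d u i := by
    obtain ⟨u, hu⟩ := not_forall_not.1 hv
    have : Nonempty {u // E u v} := ⟨⟨u, hu⟩⟩
    obtain ⟨w, hw⟩ := exists_eq_ciInf_of_finite (f := fun u : {u // E u v} => d u i)
    exact ⟨w, w.2, by simp only [hm, ← hw]⟩
  have hbound : ∀ v t, (Finset.univ.filter fun i => t ≤ d v i).card ≤ k + 1 - t := by
    intro v
    induction v using hwf.induction with
    | _ v ih =>
      by_cases hv : IsSource E v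
      · intro t
        rw [hd0 v hv]
        cases t with
        | zero => simp
        | succ t => simp
      · obtain ⟨u, hu⟩ := not_forall_not.1 hv
        rw [hd v hv]
        refine hcard _ fun t => le_trans (Finset.card_le_card fun i hi => ?_) (ih u hu t)
        have h1 := (Finset.mem_filter.1 hi).2
        have h2 := hm_le hu i
        exact Finset.mem_filter.2 ⟨Finset.mem_univ _, by omega⟩
  have hle (v : V) (i : Fin k) : d v i ≤ k := by
    by_contra! h
    have h1 := hbound v (k + 1)
    rw [Nat.sub_self, Nat.le_zero, Finset.card_eq_zero] at h1
    exact Finset.notMem_empty i (h1 ▸ Finset.mem_filter.2 ⟨Finset.mem_univ _, h⟩)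
  have hreach (i : Fin k) : ∀ v, ∃ x, d x i = 0 ∧ ReachesIn E (d v i) x v := by
    intro v
    induction v using hwf.induction with
    | _ v ih =>
      by_cases h0 : d v i = 0
      · exact ⟨v, h0, h0 ▸ rfl⟩
      · have hv : ¬ IsSource E v := fun hv => h0 (by simp [hd0 v hv])
        obtain ⟨u, hu, hmu⟩ := hm_eq hv i
        obtain ⟨x, hx, hxu⟩ := ih u hu
        refine ⟨x, hx, ?_⟩
        rcases hR (m v) i with h | h
        · rw [hd v hv, h, hmu, add_comm]
          exact hxu.snoc hu
        · exact absurd (by rw [hd v hv, h.1]) h0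
  refine ⟨d, fun i => ⟨fun u hu v hv huv => ?_, fun v _ => ?_⟩, hd0 r hr,
    fun v hv i j hi hj => ?_, ?_⟩
  · have hu : d u i = 0 := hu
    have hv : d v i = 0 := hv
    rw [hd v fun h => h u huv] at hv
    have h1 := hm_le huv i
    have h2 : 1 ≤ m v i := Nat.le_add_right 1 _
    rcases hR (m v) i with h | h <;> omega
  · obtain ⟨x, hx, hxv⟩ := hreach i v
    exact ⟨x, hx, hxv.mono (hle v i)⟩
  · have hs : ¬ IsSource E v := fun h => hv (hr' v h)
    rw [hd v hs] at hi hj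
    exact hinj (m v) (fun i => Nat.le_add_right 1 _) i j hi hj
  · obtain ⟨b, hb⟩ := exists_ne r
    obtain ⟨a, ha, hmin⟩ := hwf.has_min {v | v ≠ r} ⟨b, hb⟩
    have hs : ¬ IsSource E a := fun h => ha (hr' a h)
    refine ⟨a, ha, fun i hi => ?_⟩
    obtain ⟨u, hu, hmu⟩ := hm_eq hs i
    obtain rfl : u = r := by
      by_contra hne
      exact hmin u hne hu
    rw [hd0 u hr, Pi.zero_apply] at hmu
    rw [hd a hs] at hi
    rcases hR (m a) i with h | h <;> omega

/-- For $k \ge 1$: an acyclic digraph with at least two vertices and exactly one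
source has a $k$-kernel $K$ with $k(|K|-1) \le |G|-2$. -/
theorem stmt_9 {V : Type*} [Fintype V] (E : V → V → Prop) (k : ℕ) (hk : 1 ≤ k)
    (hirr : ∀ v, ¬ E v v) (hac : AcyclicRel E)
    (hcard : 2 ≤ Fintype.card V) (hsrc : ∃! r : V, IsSource E r) :
    ∃ K : Finset V, IsKernel E k (↑K : Set V) ∧
      (k : ℤ) * ((K.card : ℤ) - 1) ≤ (Fintype.card V : ℤ) - 2 := by
  obtain ⟨r, hr, hr'⟩ := hsrc
  classical
  have : Nontrivial V := Fintype.one_lt_card_iff_nontrivial.1 hcard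
  obtain ⟨d, hker, hdr, hinj, a, har, ha⟩ := exists_kernel_family hk hac hr hr'
  let L : Fin k → Finset V := fun i => Finset.univ.filter fun v => v ≠ r ∧ d v i = 0
  have hdisj : ((Finset.univ : Finset (Fin k)) : Set (Fin k)).PairwiseDisjoint L := by
    intro i _ j _ hij
    refine Finset.disjoint_left.2 fun v hi hj => hij ?_
    obtain ⟨hv, hi⟩ := (Finset.mem_filter.1 hi).2
    exact hinj v hv i j hi (Finset.mem_filter.1 hj).2.2
  have hsum : ∑ i, (L i).card ≤ Fintype.card V - 2 := by
    rw [← Finset.card_biUnion hdisj, ← Finset.card_pair har, ← Finset.card_compl]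
    refine Finset.card_le_card fun v hv => ?_
    obtain ⟨i, -, hi⟩ := Finset.mem_biUnion.1 hv
    obtain ⟨hvr, hi⟩ := (Finset.mem_filter.1 hi).2
    have hva : v ≠ a := by
      rintro rfl
      exact ha i hi
    simp [hvr, hva]
  obtain ⟨i, -, hi⟩ := Finset.exists_min_image Finset.univ (fun i => (L i).card) ⟨⟨0, hk⟩, by simp⟩
  have hmul : k * (L i).card ≤ Fintype.card V - 2 := by
    refine le_trans ?_ hsum
    simpa using Finset.card_nsmul_le_sum Finset.univ (fun j => (L j).card) _ hi
  have hins : ((insert r (L i) : Finset V) : Set V) = {v | d v i = 0} := by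
    ext v
    by_cases hv : v = r
    · simp [hv, hdr]
    · simp [hv, L]
  refine ⟨insert r (L i), hins ▸ hker i, ?_⟩
  rw [Finset.card_insert_of_notMem (by simp [L])]
  push_cast
  rw [add_sub_cancel_right]
  zify [hcard] at hmul
  exact hmul
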